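/- arXiv:1103.5859 — 5 statements merged into one kernel-verified Lean document; each statement's English description precedes it below -/
import Mathlib

section
/- Let E and T be nonempty types, 𝒞 = ℓ∞(E × T) and 𝒳 = ℓ∞(E). Let A be a bounded linear operator on 𝒳, let b, d : E × T → ℝ be bounded functions, and let l be a nonzero real number. Set W := l·Id + A, β₀ := inf_{(x,t)} |b(x,t)|, m := inf_{(x,t)} |l − d(x,t)/b(x,t)|. Assume β₀ > 0 and m > 0. Then for every k ∈ ℕ the function c_k(x,t) := 1/( b(x,t) · (l − d(x,t)/b(x,t))^{k+1} ) is bounded with |c_k(x,t)| ≤ 1/(β₀ · m^{k+1}), the operator (W^k)~ ∘ M_{c_k} on 𝒞 has operator norm at most ‖W‖^k/(β₀ · m^{k+1}), and if moreover λ := ‖W‖/m < 1 then the family of operators ( (W^k)~ ∘ M_{c_k} )_{k∈ℕ} is summable in the operator norm of bounded operators on 𝒞. -/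
open scoped ENNReal

/-- The powers of an operator satisfy `‖W ^ k‖ ≤ ‖W‖ ^ k`, also for `k = 0` and on a trivial
space. -/
theorem ContinuousLinearMap.norm_pow_le_pow_norm {F : Type*} [NormedAddCommGroup F]
    [NormedSpace ℝ F] (W : F →L[ℝ] F) (k : ℕ) : ‖W ^ k‖ ≤ ‖W‖ ^ k := by
  rcases Nat.eq_zero_or_pos k with rfl | hk
  · simpa only [pow_zero, ContinuousLinearMap.one_def] using
      ContinuousLinearMap.norm_id_le (𝕜 := ℝ) (E := F)
  · exact norm_pow_le' W hk

/-- An operator on `ℓ∞(E × T)` acting slicewise in the space variable as `B` has norm at most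
`‖B‖`. -/
theorem norm_slicewise_le {E T : Type*}
    (B : lp (fun _ : E => ℝ) ∞ →L[ℝ] lp (fun _ : E => ℝ) ∞)
    (L : lp (fun _ : E × T => ℝ) ∞ →L[ℝ] lp (fun _ : E × T => ℝ) ∞)
    (hL : ∀ (X : lp (fun _ : E × T => ℝ) ∞) (t : T) (Y : lp (fun _ : E => ℝ) ∞),
      (∀ x : E, Y x = X (x, t)) → ∀ x : E, L X (x, t) = B Y x) :
    ‖L‖ ≤ ‖B‖ := by
  refine L.opNorm_le_bound (norm_nonneg B) fun X => ?_
  refine lp.norm_le_of_forall_le (by positivity) ?_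
  rintro ⟨x, t⟩
  have hX : ∀ y : E, ‖X (y, t)‖ ≤ ‖X‖ := fun y => lp.norm_apply_le_norm ENNReal.top_ne_zero X (y, t)
  let Y : lp (fun _ : E => ℝ) ∞ :=
    ⟨fun y => X (y, t), memℓp_infty ⟨‖X‖, Set.forall_mem_range.2 hX⟩⟩
  have hY : ‖Y‖ ≤ ‖X‖ := lp.norm_le_of_forall_le (norm_nonneg X) hX
  rw [hL X t Y (fun _ => rfl) x]
  calc ‖B Y x‖ ≤ ‖B Y‖ := lp.norm_apply_le_norm ENNReal.top_ne_zero (B Y) x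
    _ ≤ ‖B‖ * ‖Y‖ := B.le_opNorm Y
    _ ≤ ‖B‖ * ‖X‖ := by gcongr

/-- Multiplication on `ℓ∞` by a function bounded by `C` has operator norm at most `C`. -/
theorem norm_multiplication_le {ι : Type*} {r : ι → ℝ} {C : ℝ} (hC : 0 ≤ C)
    (hr : ∀ i, |r i| ≤ C) (M : lp (fun _ : ι => ℝ) ∞ →L[ℝ] lp (fun _ : ι => ℝ) ∞)
    (hM : ∀ (X : lp (fun _ : ι => ℝ) ∞) (i : ι), M X i = r i * X i) :
    ‖M‖ ≤ C := by
  refine M.opNorm_le_bound hC fun X => lp.norm_le_of_forall_le (by positivity) fun i => ?_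
  rw [hM, norm_mul]
  exact mul_le_mul (hr i) (lp.norm_apply_le_norm ENNReal.top_ne_zero X i) (norm_nonneg _) hC

/-- Boundedness of the coefficients `c_k`, the operator-norm bound
`‖(W^k)~ ∘ M_{c_k}‖ ≤ ‖W‖^k/(β₀ m^{k+1})`, and summability in operator norm of the
family `((W^k)~ ∘ M_{c_k})_k` when `λ = ‖W‖/m < 1`. -/
theorem summability_of_series_terms {E T : Type*} [Nonempty E] [Nonempty T]
    (A : lp (fun _ : E => ℝ) ∞ →L[ℝ] lp (fun _ : E => ℝ) ∞)
    (b d : E × T → ℝ)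
    (hb_bdd : BddAbove (Set.range fun p : E × T => |b p|))
    (hd_bdd : BddAbove (Set.range fun p : E × T => |d p|))
    (l : ℝ) (hl : l ≠ 0)
    (W : lp (fun _ : E => ℝ) ∞ →L[ℝ] lp (fun _ : E => ℝ) ∞)
    (hW : W = l • ContinuousLinearMap.id ℝ (lp (fun _ : E => ℝ) ∞) + A)
    (β₀ m : ℝ)
    (hβ₀ : β₀ = ⨅ p : E × T, |b p|)
    (hm : m = ⨅ p : E × T, |l - d p / b p|)
    (hβ₀_pos : 0 < β₀) (hm_pos : 0 < m)
    (liftWpow : ℕ → lp (fun _ : E × T => ℝ) ∞ →L[ℝ] lp (fun _ : E × T => ℝ) ∞)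
    (hliftWpow : ∀ (k : ℕ) (X : lp (fun _ : E × T => ℝ) ∞) (t : T) (Y : lp (fun _ : E => ℝ) ∞),
      (∀ x : E, Y x = X (x, t)) → ∀ x : E, liftWpow k X (x, t) = (W ^ k) Y x)
    (Mc : ℕ → lp (fun _ : E × T => ℝ) ∞ →L[ℝ] lp (fun _ : E × T => ℝ) ∞)
    (hMc : ∀ (k : ℕ) (X : lp (fun _ : E × T => ℝ) ∞) (p : E × T),
      Mc k X p = (1 / (b p * (l - d p / b p) ^ (k + 1))) * X p) :
    (∀ (k : ℕ) (p : E × T),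
        |1 / (b p * (l - d p / b p) ^ (k + 1))| ≤ 1 / (β₀ * m ^ (k + 1))) ∧
    (∀ k : ℕ, ‖(liftWpow k).comp (Mc k)‖ ≤ ‖W‖ ^ k / (β₀ * m ^ (k + 1))) ∧
    (‖W‖ / m < 1 → Summable fun k : ℕ => (liftWpow k).comp (Mc k)) := by
  have hb (p : E × T) : β₀ ≤ |b p| :=
    hβ₀ ▸ ciInf_le ⟨0, Set.forall_mem_range.2 fun _ => abs_nonneg _⟩ p
  have hd (p : E × T) : m ≤ |l - d p / b p| :=
    hm ▸ ciInf_le (f := fun p => |l - d p / b p|)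
      ⟨0, Set.forall_mem_range.2 fun _ => abs_nonneg _⟩ p
  have coeff_le (k : ℕ) (p : E × T) :
      |1 / (b p * (l - d p / b p) ^ (k + 1))| ≤ 1 / (β₀ * m ^ (k + 1)) := by
    rw [abs_div, abs_one, abs_mul, abs_pow]
    gcongr
    exacts [hb p, hd p]
  have norm_le (k : ℕ) :
      ‖(liftWpow k).comp (Mc k)‖ ≤ ‖W‖ ^ k / (β₀ * m ^ (k + 1)) := by
    have hlift : ‖liftWpow k‖ ≤ ‖W‖ ^ k :=
      (norm_slicewise_le (W ^ k) (liftWpow k) (hliftWpow k)).trans (W.norm_pow_le_pow_norm k)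
    have hmul : ‖Mc k‖ ≤ 1 / (β₀ * m ^ (k + 1)) :=
      norm_multiplication_le (by positivity) (coeff_le k) (Mc k) (hMc k)
    calc ‖(liftWpow k).comp (Mc k)‖ ≤ ‖liftWpow k‖ * ‖Mc k‖ :=
          (liftWpow k).opNorm_comp_le (Mc k)
      _ ≤ ‖W‖ ^ k * (1 / (β₀ * m ^ (k + 1))) := by gcongr
      _ = ‖W‖ ^ k / (β₀ * m ^ (k + 1)) := by ring
  refine ⟨coeff_le, norm_le, fun hlt => ?_⟩
  have hgeom : Summable fun k : ℕ => 1 / (β₀ * m) * (‖W‖ / m) ^ k :=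
    (summable_geometric_of_lt_one (by positivity) hlt).mul_left _
  refine hgeom.of_norm_bounded fun k => (norm_le k).trans_eq ?_
  rw [div_pow, pow_succ]
  field_simp
end

section
/- Let n ∈ ℕ, let A be a continuous linear operator on ℝⁿ (equipped with the Euclidean norm), let I : ℝ → ℝⁿ be continuous, let X₀ ∈ ℝⁿ, and suppose X : ℝ → ℝⁿ is differentiable on [0,∞) with X(0) = X₀ and X'(t) = A(X(t)) + I(t) for all t ≥ 0. Then for every real number l, setting W := l·Id + A, for every t ≥ 0 the series ∑_{k=0}^∞ W^k ( e^{−l t} (t^k/k!) · X₀ + ∫₀ᵗ e^{−l(t−s)} ((t−s)^k/k!) · I(s) ds ) converges absolutely in ℝⁿ and its sum equals X(t). -/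
section

variable {E : Type*} [NormedAddCommGroup E] [NormedSpace ℝ E]

theorem ContinuousLinearMap.norm_pow_apply_le (W : E →L[ℝ] E) (k : ℕ) (v : E) :
    ‖(W ^ k) v‖ ≤ ‖W‖ ^ k * ‖v‖ := by
  induction k with
  | zero => simp
  | succ k ih =>
    rw [pow_succ', mul_apply_eq_comp, pow_succ', mul_assoc]
    exact (W.le_opNorm _).trans (by gcongr)

/-- The flow `e^{-lu} e^{uW}` of the linear equation with generator `W - l`. -/
noncomputable def shiftedFlow (l : ℝ) (W : E →L[ℝ] E) (u : ℝ) : E →L[ℝ] E :=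
  Real.exp (-l * u) • NormedSpace.exp (u • W)

theorem shiftedFlow_zero (l : ℝ) (W : E →L[ℝ] E) : shiftedFlow l W 0 = 1 := by
  simp [shiftedFlow]

variable [CompleteSpace E]

theorem hasDerivAt_shiftedFlow (l : ℝ) (W : E →L[ℝ] E) (u : ℝ) :
    HasDerivAt (shiftedFlow l W) (shiftedFlow l W u * (W - l • 1)) u := by
  have h1 : HasDerivAt (fun u : ℝ => Real.exp (-l * u)) (Real.exp (-l * u) * -l) u := by
    simpa using ((hasDerivAt_id u).const_mul (-l)).exp
  refine (h1.smul (hasDerivAt_exp_smul_const W u)).congr_deriv ?_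
  simp only [shiftedFlow, mul_sub, smul_mul_assoc, mul_smul_comm, mul_one]
  module

theorem continuous_shiftedFlow (l : ℝ) (W : E →L[ℝ] E) : Continuous (shiftedFlow l W) :=
  continuous_iff_continuousAt.2 fun u => (hasDerivAt_shiftedFlow l W u).continuousAt

theorem hasSum_shiftedFlow_apply (l : ℝ) (W : E →L[ℝ] E) (u : ℝ) (v : E) :
    HasSum (fun k : ℕ => (W ^ k) ((Real.exp (-l * u) * (u ^ k / (k.factorial : ℝ))) • v))
      (shiftedFlow l W u v) := by
  have h := ((NormedSpace.exp_series_hasSum_exp' (𝕂 := ℝ) (u • W)).const_smul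
    (Real.exp (-l * u))).mapL (ContinuousLinearMap.apply ℝ E v)
  simpa [shiftedFlow, smul_pow, smul_smul, div_eq_inv_mul] using h

/-- Variation of constants. -/
theorem eq_shiftedFlow_add_integral {l : ℝ} {W : E →L[ℝ] E} {I X : ℝ → E} (hI : Continuous I)
    (hX : ∀ t ∈ Set.Ici (0 : ℝ),
      HasDerivWithinAt X ((W - l • 1 : E →L[ℝ] E) (X t) + I t) (Set.Ici 0) t)
    {t : ℝ} (ht : 0 ≤ t) :
    X t = shiftedFlow l W t (X 0) + ∫ s in (0 : ℝ)..t, shiftedFlow l W (t - s) (I s) := by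
  have hderiv (s : ℝ) (hs : 0 ≤ s) :
      HasDerivWithinAt (fun s => shiftedFlow l W (t - s) (X s))
        (shiftedFlow l W (t - s) (I s)) (Set.Ici 0) s := by
    have hsub : HasDerivAt (fun s : ℝ => t - s) (-1) s := by
      simpa using (hasDerivAt_id s).const_sub t
    have hflow := (hasDerivAt_shiftedFlow l W (t - s)).scomp s hsub
    refine (hflow.hasDerivWithinAt.clm_apply (hX s hs)).congr_deriv ?_
    rw [neg_one_smul, neg_apply, mul_apply_eq_comp, map_add, Function.comp_apply,
      neg_add_cancel_left]
  have hcont : Continuous fun s => shiftedFlow l W (t - s) (I s) :=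
    ((continuous_shiftedFlow l W).comp (by fun_prop)).clm_apply hI
  rw [intervalIntegral.integral_eq_sub_of_hasDeriv_right_of_le ht
    (fun s hs => ((hderiv s hs.1).mono Set.Icc_subset_Ici_self).continuousWithinAt)
    (fun s hs => (hderiv s hs.1.le).mono fun r hr => hs.1.le.trans (Set.mem_Ioi.1 hr).le)
    (hcont.intervalIntegrable _ _)]
  simp [shiftedFlow_zero]

theorem hasSum_integral_shiftedFlow (l : ℝ) (W : E →L[ℝ] E) {I : ℝ → E} (hI : Continuous I)
    {t : ℝ} (ht : 0 ≤ t) :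
    HasSum (fun k : ℕ => (W ^ k) (∫ s in (0 : ℝ)..t,
        (Real.exp (-l * (t - s)) * ((t - s) ^ k / (k.factorial : ℝ))) • I s))
      (∫ s in (0 : ℝ)..t, shiftedFlow l W (t - s) (I s)) := by
  have hcont (k : ℕ) : Continuous fun s : ℝ =>
      (Real.exp (-l * (t - s)) * ((t - s) ^ k / (k.factorial : ℝ))) • I s := by fun_prop
  simp_rw [← fun k : ℕ => (W ^ k).intervalIntegral_comp_comm
    ((hcont k).intervalIntegrable (μ := MeasureTheory.volume) 0 t)]
  have hsum := Real.summable_pow_div_factorial (t * ‖W‖)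
  refine intervalIntegral.hasSum_integral_of_dominated_convergence
    (fun k s => Real.exp (-l * (t - s)) * ‖I s‖ * ((t * ‖W‖) ^ k / (k.factorial : ℝ)))
    (fun k => ((W ^ k).continuous.comp (hcont k)).aestronglyMeasurable)
    (fun k => Filter.Eventually.of_forall fun s hs => ?_)
    (Filter.Eventually.of_forall fun s _ => hsum.mul_left _) ?_
    (Filter.Eventually.of_forall fun s _ => hasSum_shiftedFlow_apply l W (t - s) (I s))
  · rw [Set.uIoc_of_le ht] at hs
    have h0 : 0 ≤ t - s := sub_nonneg.2 hs.2
    calc _ ≤ ‖W‖ ^ k * ‖(Real.exp (-l * (t - s)) * ((t - s) ^ k / (k.factorial : ℝ))) • I s‖ :=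
          W.norm_pow_apply_le k _
      _ = ‖W‖ ^ k * (Real.exp (-l * (t - s)) * ((t - s) ^ k / (k.factorial : ℝ)) * ‖I s‖) := by
          rw [norm_smul, Real.norm_of_nonneg (by positivity)]
      _ ≤ ‖W‖ ^ k * (Real.exp (-l * (t - s)) * (t ^ k / (k.factorial : ℝ)) * ‖I s‖) := by
          gcongr
          linarith [hs.1]
      _ = _ := by ring
  · simp_rw [tsum_mul_left]
    exact Continuous.intervalIntegrable (by fun_prop) _ _

end

/-- **Series expansion of the solution of the linear non-autonomous ODE**
`dX = (A·X + I) dt`, `X(0) = X₀`: for every `l ∈ ℝ`, with `W = l·Id + A`, and every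
`t ≥ 0`, the series `∑ₖ Wᵏ (e^{-lt} (tᵏ/k!) X₀ + ∫₀ᵗ e^{-l(t-s)} ((t-s)ᵏ/k!) I(s) ds)`
converges absolutely and its sum is `X(t)`. -/
theorem series_expansion_linear_ode (n : ℕ)
    (A : EuclideanSpace ℝ (Fin n) →L[ℝ] EuclideanSpace ℝ (Fin n))
    (I : ℝ → EuclideanSpace ℝ (Fin n)) (hI : Continuous I)
    (X₀ : EuclideanSpace ℝ (Fin n))
    (X : ℝ → EuclideanSpace ℝ (Fin n))
    (hX₀ : X 0 = X₀)
    (hX : ∀ t ∈ Set.Ici (0 : ℝ), HasDerivWithinAt X (A (X t) + I t) (Set.Ici 0) t)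
    (l : ℝ)
    (W : EuclideanSpace ℝ (Fin n) →L[ℝ] EuclideanSpace ℝ (Fin n))
    (hW : W = l • ContinuousLinearMap.id ℝ (EuclideanSpace ℝ (Fin n)) + A)
    (t : ℝ) (ht : 0 ≤ t) :
    Summable (fun k : ℕ =>
      ‖(W ^ k) ((Real.exp (-l * t) * (t ^ k / (k.factorial : ℝ))) • X₀
        + ∫ s in (0 : ℝ)..t,
            (Real.exp (-l * (t - s)) * ((t - s) ^ k / (k.factorial : ℝ))) • I s)‖) ∧
    HasSum (fun k : ℕ =>
      (W ^ k) ((Real.exp (-l * t) * (t ^ k / (k.factorial : ℝ))) • X₀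
        + ∫ s in (0 : ℝ)..t,
            (Real.exp (-l * (t - s)) * ((t - s) ^ k / (k.factorial : ℝ))) • I s))
      (X t) := by
  subst hX₀
  have hWA : W - l • 1 = A := by rw [hW]; exact add_sub_cancel_left _ _
  rw [summable_norm_iff, eq_shiftedFlow_add_integral (l := l) (X := X) (W := W) hI
    (by simpa only [hWA] using hX) ht]
  simp_rw [map_add]
  have h := (hasSum_shiftedFlow_apply l W t (X 0)).add (hasSum_integral_shiftedFlow l W hI ht)
  exact ⟨h.summable, h⟩
end

section
/- Let β and l be real numbers with β > 4l > 0, set Δ := √(1 − 4l/β) ∈ (0,1), and define u : ℝ → ℝ by u(t) = (1/Δ) e^{−βt/2} ( sinh(βΔt/2) + Δ·cosh(βΔt/2) ) for t ≥ 0 and u(t) = 0 for t < 0. Then u is integrable on ℝ, and for every ξ ∈ ℝ its Fourier transform satisfies ∫_ℝ u(t) e^{−2πiξt} dt = 1 / ( l·ĝ(ξ) + 2πiξ ), where ĝ(ξ) := β/(β + 2πiξ). -/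
open Real

/-- The kernel `u` is a combination of two decaying exponentials. -/
lemma exp_mul_sinh_add_cosh (β Δ t : ℝ) :
    (1 / Δ) * Real.exp (-β * t / 2) *
        (Real.sinh (β * Δ * t / 2) + Δ * Real.cosh (β * Δ * t / 2))
      = (1 + Δ) / (2 * Δ) * Real.exp (-(β * (1 - Δ) / 2) * t)
        + (Δ - 1) / (2 * Δ) * Real.exp (-(β * (1 + Δ) / 2) * t) := by
  have h1 : -(β * (1 - Δ) / 2) * t = -β * t / 2 + β * Δ * t / 2 := by ring
  have h2 : -(β * (1 + Δ) / 2) * t = -β * t / 2 + -(β * Δ * t / 2) := by ring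
  rw [h1, h2, Real.exp_add, Real.exp_add, Real.sinh_eq, Real.cosh_eq]
  ring

/-- **The kernel `u` generating the operator `𝒰`** in the regime `β > 4l > 0`:
`u(t) = (1/Δ) e^{-βt/2}(sinh(βΔt/2) + Δ cosh(βΔt/2))` for `t ≥ 0` (with
`Δ = √(1 - 4l/β)`) is integrable and its Fourier transform is
`1/(lĝ(ξ) + 2πiξ)` where `ĝ(ξ) = β/(β + 2πiξ)`. -/
theorem kernel_U_fourier_transform (β l : ℝ) (hl : 0 < 4 * l) (hβ : 4 * l < β)
    (Δ : ℝ) (hΔ : Δ = Real.sqrt (1 - 4 * l / β))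
    (u : ℝ → ℝ)
    (hu : ∀ t : ℝ, u t = if 0 ≤ t then
        (1 / Δ) * Real.exp (-β * t / 2) *
          (Real.sinh (β * Δ * t / 2) + Δ * Real.cosh (β * Δ * t / 2))
      else 0) :
    MeasureTheory.Integrable u ∧
    ∀ ξ : ℝ, ∫ t : ℝ, ((u t : ℝ) : ℂ) *
          Complex.exp (-2 * (π : ℂ) * Complex.I * (ξ : ℂ) * (t : ℂ))
      = 1 / ((l : ℂ) * ((β : ℂ) / ((β : ℂ) + 2 * (π : ℂ) * Complex.I * (ξ : ℂ)))
          + 2 * (π : ℂ) * Complex.I * (ξ : ℂ)) := by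
  have hβ0 : 0 < β := hl.trans hβ
  have hfrac : 4 * l / β < 1 := (div_lt_one hβ0).2 hβ
  have hfrac0 : 0 < 4 * l / β := div_pos hl hβ0
  have hΔ0 : 0 < Δ := hΔ ▸ Real.sqrt_pos.2 (by linarith)
  have hΔsq : Δ ^ 2 = 1 - 4 * l / β := by rw [hΔ, Real.sq_sqrt (by linarith)]
  have hΔ1 : Δ < 1 := by nlinarith
  have hprod : β * (1 - Δ) / 2 * (β * (1 + Δ) / 2) = β * l := by
    calc _ = β ^ 2 * (1 - Δ ^ 2) / 4 := by ring
      _ = β * l := by rw [hΔsq]; field_simp; ring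
  set p := β * (1 - Δ) / 2 with hp
  set q := β * (1 + Δ) / 2 with hq
  have hp0 : 0 < p := div_pos (mul_pos hβ0 (by linarith)) two_pos
  have hq0 : 0 < q := div_pos (mul_pos hβ0 (by linarith)) two_pos
  have hu' : u = (Set.Ici (0 : ℝ)).indicator fun t =>
      (1 + Δ) / (2 * Δ) * Real.exp (-p * t) + (Δ - 1) / (2 * Δ) * Real.exp (-q * t) := by
    ext t
    rw [hu, exp_mul_sinh_add_cosh]
    simp only [Set.indicator, Set.mem_Ici, hp, hq]
  refine ⟨?_, fun ξ => ?_⟩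
  · rw [hu', MeasureTheory.integrable_indicator_iff measurableSet_Ici,
      integrableOn_Ici_iff_integrableOn_Ioi]
    exact ((integrableOn_exp_mul_Ioi (neg_lt_zero.2 hp0) 0).const_mul _).add
      ((integrableOn_exp_mul_Ioi (neg_lt_zero.2 hq0) 0).const_mul _)
  · set w : ℂ := 2 * (π : ℂ) * Complex.I * (ξ : ℂ) with hw
    have hwre : w.re = 0 := by simp [hw]
    have hre (a : ℝ) : (-((a : ℂ) + w)).re = -a := by simp [hwre]
    have hne (a : ℝ) (ha : 0 < a) : (a : ℂ) + w ≠ 0 := fun h => by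
      have := hre a
      rw [h] at this
      simp at this
      exact ha.ne' this
    have hpre : (-((p : ℂ) + w)).re < 0 := by rw [hre]; linarith
    have hqre : (-((q : ℂ) + w)).re < 0 := by rw [hre]; linarith
    have hfun : (fun t : ℝ => ((u t : ℝ) : ℂ) *
        Complex.exp (-2 * (π : ℂ) * Complex.I * (ξ : ℂ) * (t : ℂ))) =
        (Set.Ici (0 : ℝ)).indicator fun t =>
          (1 + (Δ : ℂ)) / (2 * Δ) * Complex.exp (-((p : ℂ) + w) * t)
          + ((Δ : ℂ) - 1) / (2 * Δ) * Complex.exp (-((q : ℂ) + w) * t) := by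
      ext t
      rw [hu']
      by_cases ht : t ∈ Set.Ici (0 : ℝ)
      · have hexp (a : ℝ) : Complex.exp (-((a : ℂ) + w) * t) = Complex.exp (-(a : ℂ) * t) *
            Complex.exp (-2 * (π : ℂ) * Complex.I * (ξ : ℂ) * (t : ℂ)) := by
          rw [← Complex.exp_add, hw]
          congr 1
          ring
        rw [Set.indicator_of_mem ht, Set.indicator_of_mem ht, hexp, hexp]
        push_cast
        ring
      · rw [Set.indicator_of_notMem ht, Set.indicator_of_notMem ht]
        simp
    rw [hfun, MeasureTheory.integral_indicator measurableSet_Ici,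
      MeasureTheory.integral_Ici_eq_integral_Ioi,
      MeasureTheory.integral_add ((integrableOn_exp_mul_complex_Ioi hpre 0).const_mul _)
        ((integrableOn_exp_mul_complex_Ioi hqre 0).const_mul _),
      MeasureTheory.integral_const_mul, MeasureTheory.integral_const_mul,
      integral_exp_mul_complex_Ioi hpre, integral_exp_mul_complex_Ioi hqre]
    have hpw := hne p hp0
    have hqw := hne q hq0
    have hβw := hne β hβ0
    have hΔc : (Δ : ℂ) ≠ 0 := by exact_mod_cast hΔ0.ne'
    have hprodc : (p : ℂ) * q = β * l := by exact_mod_cast hprod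
    have hsum : (p : ℂ) + q = β := by
      have : p + q = β := by rw [hp, hq]; ring
      exact_mod_cast this
    have hdiff : (q : ℂ) - p = β * Δ := by
      have : q - p = β * Δ := by rw [hp, hq]; ring
      exact_mod_cast this
    have hden : (l : ℂ) * (β / (β + w)) + w = (p + w) * (q + w) / (β + w) := by
      field_simp
      linear_combination -hprodc - w * hsum
    rw [hden, one_div_div, Complex.ofReal_zero, mul_zero, mul_zero, Complex.exp_zero,
      neg_div_neg_eq, neg_div_neg_eq]
    field_simp
    linear_combination hdiff + Δ * hsum
end

section
/- Let β and l be real numbers with 4l > β > 0, set Δ' := √(4l/β − 1) > 0, and define v : ℝ → ℝ by v(t) = (2/Δ') e^{−βt/2} sin(βΔ' t/2) for t ≥ 0 and v(t) = 0 for t < 0. Then v is integrable on ℝ, and for every ξ ∈ ℝ its Fourier transform satisfies ∫_ℝ v(t) e^{−2πiξt} dt = ĝ(ξ) / ( l·ĝ(ξ) + 2πiξ ), where ĝ(ξ) := β/(β + 2πiξ). -/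
open Real

theorem exp_neg_mul_mul_sin_eq (z : ℂ) (ω t : ℝ) :
    Complex.exp (-z * t) * Complex.sin (ω * t) =
      (Complex.exp ((-z - ω * Complex.I) * t) - Complex.exp ((-z + ω * Complex.I) * t)) *
        (Complex.I / 2) := by
  have h₁ : (-z - ω * Complex.I) * t = -z * t + -(ω * t) * Complex.I := by ring
  have h₂ : (-z + ω * Complex.I) * t = -z * t + (ω * t) * Complex.I := by ring
  rw [Complex.sin, h₁, h₂, Complex.exp_add, Complex.exp_add]
  ring

theorem integrableOn_exp_neg_mul_mul_sin {z : ℂ} (hz : 0 < z.re) (ω : ℝ) :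
    MeasureTheory.IntegrableOn
      (fun t : ℝ => Complex.exp (-z * t) * Complex.sin (ω * t)) (Set.Ioi 0) := by
  simp_rw [exp_neg_mul_mul_sin_eq]
  exact ((integrableOn_exp_mul_complex_Ioi (by simpa using hz) 0).sub
    (integrableOn_exp_mul_complex_Ioi (by simpa using hz) 0)).mul_const _

/-- The Laplace transform of `t ↦ sin (ω t)` on the right half-plane. -/
theorem integral_exp_neg_mul_mul_sin {z : ℂ} (hz : 0 < z.re) (ω : ℝ) :
    z ^ 2 + ω ^ 2 ≠ 0 ∧
    ∫ t : ℝ in Set.Ioi 0, Complex.exp (-z * t) * Complex.sin (ω * t) =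
      ω / (z ^ 2 + ω ^ 2) := by
  have h₁ : (-z - ω * Complex.I).re < 0 := by simpa using hz
  have h₂ : (-z + ω * Complex.I).re < 0 := by simpa using hz
  have n₁ : -z - ω * Complex.I ≠ 0 := fun h => by simp [h] at h₁
  have n₂ : -z + ω * Complex.I ≠ 0 := fun h => by simp [h] at h₂
  have key : z ^ 2 + ω ^ 2 = (-z - ω * Complex.I) * (-z + ω * Complex.I) := by
    linear_combination (ω : ℂ) ^ 2 * Complex.I_sq
  refine ⟨key ▸ mul_ne_zero n₁ n₂, ?_⟩
  simp_rw [exp_neg_mul_mul_sin_eq]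
  rw [MeasureTheory.integral_mul_const, MeasureTheory.integral_sub
      (integrableOn_exp_mul_complex_Ioi h₁ 0) (integrableOn_exp_mul_complex_Ioi h₂ 0),
    integral_exp_mul_complex_Ioi h₁, integral_exp_mul_complex_Ioi h₂, key]
  simp only [Complex.ofReal_zero, mul_zero, Complex.exp_zero]
  field_simp
  linear_combination (-2 * (ω : ℂ)) * Complex.I_sq

/-- **The kernel `v` generating the operator `𝒱`** in the oscillatory regime `4l > β > 0`:
`v(t) = (2/Δ') e^{-βt/2} sin(βΔ't/2)` for `t ≥ 0` (with `Δ' = √(4l/β - 1)`) is integrable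
and its Fourier transform is `ĝ(ξ)/(lĝ(ξ) + 2πiξ)` where `ĝ(ξ) = β/(β + 2πiξ)`. -/
theorem kernel_V_fourier_transform_oscillatory (β l : ℝ) (hβ : 0 < β) (hl : β < 4 * l)
    (Δ' : ℝ) (hΔ' : Δ' = Real.sqrt (4 * l / β - 1))
    (v : ℝ → ℝ)
    (hv : ∀ t : ℝ, v t = if 0 ≤ t then
        (2 / Δ') * Real.exp (-β * t / 2) * Real.sin (β * Δ' * t / 2)
      else 0) :
    MeasureTheory.Integrable v ∧
    ∀ ξ : ℝ, ∫ t : ℝ, ((v t : ℝ) : ℂ) *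
          Complex.exp (-2 * (π : ℂ) * Complex.I * (ξ : ℂ) * (t : ℂ))
      = ((β : ℂ) / ((β : ℂ) + 2 * (π : ℂ) * Complex.I * (ξ : ℂ))) /
          ((l : ℂ) * ((β : ℂ) / ((β : ℂ) + 2 * (π : ℂ) * Complex.I * (ξ : ℂ)))
            + 2 * (π : ℂ) * Complex.I * (ξ : ℂ)) := by
  have hpos : 0 < 4 * l / β - 1 := by
    rw [sub_pos, one_lt_div hβ]
    exact hl
  have hΔpos : 0 < Δ' := hΔ' ▸ Real.sqrt_pos.mpr hpos
  have hΔsq : β * Δ' ^ 2 = 4 * l - β := by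
    rw [hΔ', Real.sq_sqrt hpos.le]
    field_simp
  have hv_ind (ξ : ℝ) : (fun t : ℝ => ((v t : ℝ) : ℂ) *
        Complex.exp (-2 * (π : ℂ) * Complex.I * (ξ : ℂ) * (t : ℂ))) =
      (Set.Ici 0).indicator (fun t : ℝ => (2 / Δ' : ℂ) *
        (Complex.exp (-(β / 2 + 2 * π * Complex.I * ξ : ℂ) * t) *
          Complex.sin ((β * Δ' / 2 : ℝ) * t))) := by
    funext t
    rw [hv, Set.indicator_apply]
    simp only [Set.mem_Ici]
    split_ifs
    · have hexp : -(β / 2 + 2 * π * Complex.I * ξ : ℂ) * t =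
          (-β * t / 2 : ℂ) + -2 * π * Complex.I * ξ * t := by ring
      have hsin : ((β * Δ' / 2 : ℝ) : ℂ) * t = (β * Δ' * t / 2 : ℂ) := by
        push_cast
        ring
      rw [hexp, hsin, Complex.exp_add]
      push_cast
      ring
    · simp
  have hre (ξ : ℝ) : 0 < (β / 2 + 2 * π * Complex.I * ξ : ℂ).re := by
    simpa using hβ
  constructor
  · have hint : MeasureTheory.Integrable (fun t : ℝ => ((v t : ℝ) : ℂ)) := by
      have h := hv_ind 0
      simp only [Complex.ofReal_zero, mul_zero, zero_mul, Complex.exp_zero, mul_one,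
        add_zero] at h
      rw [h, MeasureTheory.integrable_indicator_iff measurableSet_Ici,
        integrableOn_Ici_iff_integrableOn_Ioi]
      exact (integrableOn_exp_neg_mul_mul_sin (by simpa using hβ) _).const_mul _
    simpa using hint.re
  · intro ξ
    obtain ⟨hne, hval⟩ := integral_exp_neg_mul_mul_sin (hre ξ) (β * Δ' / 2)
    rw [hv_ind, MeasureTheory.integral_indicator measurableSet_Ici,
      MeasureTheory.integral_Ici_eq_integral_Ioi, MeasureTheory.integral_const_mul, hval]
    have hΔsqc : (β : ℂ) * (Δ' : ℂ) ^ 2 = 4 * l - β := by exact_mod_cast hΔsq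
    have hΔne : (Δ' : ℂ) ≠ 0 := by exact_mod_cast hΔpos.ne'
    have hgne : (β : ℂ) + 2 * π * Complex.I * ξ ≠ 0 := fun h => by
      have := congrArg Complex.re h
      simp at this
      exact hβ.ne' this
    have hden : (β / 2 + 2 * π * Complex.I * ξ : ℂ) ^ 2 + ((β * Δ' / 2 : ℝ) : ℂ) ^ 2 =
        l * β + 2 * π * Complex.I * ξ * (β + 2 * π * Complex.I * ξ) := by
      push_cast
      linear_combination (β / 4 : ℂ) * hΔsqc
    rw [hden] at hne ⊢
    generalize 2 * (π : ℂ) * Complex.I * ξ = s at hne hgne ⊢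
    have hquot : (l : ℂ) * (β / (β + s)) + s = (l * β + s * (β + s)) / (β + s) := by
      field_simp
    rw [hquot, div_div_div_cancel_right₀ hgne]
    push_cast
    field_simp
end

section
/- Let β and l be real numbers with β > 4l > 0, set Δ := √(1 − 4l/β), and define u(t) = (1/Δ) e^{−βt/2}( sinh(βΔt/2) + Δ·cosh(βΔt/2) ) and v(t) = (2/Δ) e^{−βt/2} sinh(βΔt/2) for t ≥ 0 (both vanishing for t < 0). Then: (i) for every t ≥ 0, v(t) = ∫₀ᵗ β e^{−β(t−s)} u(s) ds, i.e. v = g ∗ u where g(x) = βe^{−βx} for x ≥ 0; and (ii) u(0) = 1 and u'(t) = −l · v(t) for every t > 0. -/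
/-- The product rule for `e^{-βt/2} (p sinh(βΔt/2) + q cosh(βΔt/2))`. -/
lemma hasDerivAt_exp_mul_sinh_add_cosh (β Δ p q t : ℝ) :
    HasDerivAt (fun t : ℝ => Real.exp (-β * t / 2) *
        (p * Real.sinh (β * Δ * t / 2) + q * Real.cosh (β * Δ * t / 2)))
      (β / 2 * (Real.exp (-β * t / 2) *
        ((Δ * q - p) * Real.sinh (β * Δ * t / 2) +
          (Δ * p - q) * Real.cosh (β * Δ * t / 2)))) t := by
  have hlin (c : ℝ) : HasDerivAt (fun t : ℝ => c * t / 2) (c / 2) t := by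
    simpa using ((hasDerivAt_id t).const_mul c).div_const 2
  refine ((hlin (-β)).exp.mul (((hlin (β * Δ)).sinh.const_mul p).add
    ((hlin (β * Δ)).cosh.const_mul q))).congr_deriv ?_
  simp only [Pi.add_apply]
  ring


/-- **Time-domain relations between the kernels `u` and `v`** (regime `β > 4l > 0`,
`Δ = √(1 - 4l/β)`): (i) `v = g ∗ u` where `g(x) = βe^{-βx}` for `x ≥ 0`, i.e.
`v(t) = ∫₀ᵗ β e^{-β(t-s)} u(s) ds` for `t ≥ 0`; and (ii) `u(0) = 1` and
`u'(t) = -l·v(t)` for `t > 0`. -/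
theorem kernels_u_v_relations (β l : ℝ) (hl : 0 < 4 * l) (hβ : 4 * l < β)
    (Δ : ℝ) (hΔ : Δ = Real.sqrt (1 - 4 * l / β))
    (u v : ℝ → ℝ)
    (hu : ∀ t : ℝ, u t = if 0 ≤ t then
        (1 / Δ) * Real.exp (-β * t / 2) *
          (Real.sinh (β * Δ * t / 2) + Δ * Real.cosh (β * Δ * t / 2))
      else 0)
    (hv : ∀ t : ℝ, v t = if 0 ≤ t then
        (2 / Δ) * Real.exp (-β * t / 2) * Real.sinh (β * Δ * t / 2)
      else 0) :
    (∀ t : ℝ, 0 ≤ t → v t = ∫ s in (0 : ℝ)..t, β * Real.exp (-β * (t - s)) * u s) ∧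
    u 0 = 1 ∧
    ∀ t : ℝ, 0 < t → HasDerivAt u (-l * v t) t := by
  have hβ0 : 0 < β := hl.trans hβ
  have hpos : 0 < 1 - 4 * l / β := sub_pos.2 ((div_lt_one hβ0).2 hβ)
  have hΔ0 : Δ ≠ 0 := hΔ ▸ (Real.sqrt_pos.2 hpos).ne'
  have hsq : Δ ^ 2 = 1 - 4 * l / β := by rw [hΔ, Real.sq_sqrt hpos.le]
  have hβΔ : β * Δ ^ 2 = β - 4 * l := by rw [hsq]; field_simp
  set U : ℝ → ℝ := fun t => Real.exp (-β * t / 2) *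
    (1 / Δ * Real.sinh (β * Δ * t / 2) + 1 * Real.cosh (β * Δ * t / 2)) with hU
  set V : ℝ → ℝ := fun t => Real.exp (-β * t / 2) *
    (2 / Δ * Real.sinh (β * Δ * t / 2) + 0 * Real.cosh (β * Δ * t / 2)) with hV
  have huU {t : ℝ} (ht : 0 ≤ t) : u t = U t := by
    rw [hu, if_pos ht, hU]
    field_simp
  have hvV {t : ℝ} (ht : 0 ≤ t) : v t = V t := by
    rw [hv, if_pos ht, hV]
    ring
  refine ⟨fun t ht => ?_, by simp [huU le_rfl, hU], fun t ht => ?_⟩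
  · have hderiv (s : ℝ) : HasDerivAt (fun s => Real.exp (-β * (t - s)) * V s)
        (β * Real.exp (-β * (t - s)) * U s) s := by
      have hexp : HasDerivAt (fun s => Real.exp (-β * (t - s)))
          (Real.exp (-β * (t - s)) * (-β * (-1))) s :=
        (((hasDerivAt_id s).const_sub t).const_mul (-β)).exp
      refine (hexp.mul (hasDerivAt_exp_mul_sinh_add_cosh β Δ (2 / Δ) 0 s)).congr_deriv ?_
      simp only [hU]
      field_simp
      ring
    have hcont : Continuous fun s => β * Real.exp (-β * (t - s)) * U s := by
      fun_prop
    have hcongr : ∫ s in (0 : ℝ)..t, β * Real.exp (-β * (t - s)) * u s =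
        ∫ s in (0 : ℝ)..t, β * Real.exp (-β * (t - s)) * U s := by
      refine intervalIntegral.integral_congr fun s hs => ?_
      rw [Set.uIcc_of_le ht] at hs
      simp only [huU hs.1]
    rw [hcongr, intervalIntegral.integral_eq_sub_of_hasDerivAt (fun s _ => hderiv s)
      (hcont.intervalIntegrable 0 t), hvV ht]
    simp [hV]
  · have heq : u =ᶠ[nhds t] U := by
      filter_upwards [Ioi_mem_nhds ht] with s hs using huU (le_of_lt hs)
    refine ((hasDerivAt_exp_mul_sinh_add_cosh β Δ (1 / Δ) 1 t).congr_of_eventuallyEq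
      heq).congr_deriv ?_
    simp only [hvV ht.le, hV]
    generalize Real.sinh (β * Δ * t / 2) = S
    field_simp
    linear_combination S * hβΔ
end
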